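/- Let G=(V,E) be a correlation clustering instance, β,λ∈(0,1), 𝒞 any clustering of V, k∈[n], and U⊆V any subset with |U|=k. Define g^+_1 = Σ_{u∈U} |φ^+_1(u)|, g^+_2 = Σ_{u∈U} |φ^+_2(u)|, and g^+_4 = Σ_{u∈U} |φ^+_4(u)|, where φ^+_1={uv∈E : C(u)≠C(v)}, φ^+_2={uv∈E∖E_H : C(u)=C(v)}, and φ^+_4={uv∈E_H∖E_G̃ : C(u)=C(v)}. Then g^+_1 + g^+_2 + g^+_4 ≤ (3/β + 1/λ + 1/(βλ) + 1)·cost^k_𝒞. -/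

import Mathlib

open Finset

attribute [local instance] Classical.propDecidable

noncomputable section

variable {V : Type*}

/-- The neighborhood of `u` in the graph of `+`edges `E` (contains `u` itself,
since `E` contains all self-loops). -/
def Nbr [Fintype V] (E : V → V → Prop) (u : V) : Finset V :=
  Finset.univ.filter (fun v => E u v)

/-- The degree `d(u) = |N(u)|`. -/
def deg [Fintype V] (E : V → V → Prop) (u : V) : ℕ := (Nbr E u).card

/-- `M_{uv} = max (d(u), d(v))`. -/
def Mdeg [Fintype V] (E : V → V → Prop) (u v : V) : ℕ := max (deg E u) (deg E v)

/-- The pruned edge set `E_H = {uv ∈ E : |N(u) Δ N(v)| ≤ β · M_{uv}}`. -/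
def EH [Fintype V] (β : ℝ) (E : V → V → Prop) (u v : V) : Prop :=
  E u v ∧ ((symmDiff (Nbr E u) (Nbr E v)).card : ℝ) ≤ β * (Mdeg E u v : ℝ)

/-- The neighborhood of `u` in the pruned graph `H`. -/
def NH [Fintype V] (β : ℝ) (E : V → V → Prop) (u : V) : Finset V :=
  Finset.univ.filter (fun v => EH β E u v)

/-- The fractional solution: `x_{uu} = 0` and
`x_{uv} = 1 − |N_H(u) ∩ N_H(v)| / M_{uv}` for `u ≠ v`. -/
def xval [Fintype V] (β : ℝ) (E : V → V → Prop) (u v : V) : ℝ :=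
  if u = v then 0 else 1 - ((NH β E u ∩ NH β E v).card : ℝ) / (Mdeg E u v : ℝ)

/-- `cost_𝒞(u)`: the number of pairs incident to `u` in disagreement with respect
to the clustering `C` (given as a labelling function). -/
def costC [Fintype V] {α : Type*} (E : V → V → Prop) (C : V → α) (u : V) : ℕ :=
  (Finset.univ.filter
    (fun v => (E u v ∧ C u ≠ C v) ∨ (¬ E u v ∧ v ≠ u ∧ C u = C v))).card

/-- The top-`k` norm `cost^k_𝒞` of the disagreement vector of the clustering `C`:
the maximum of `∑_{u ∈ T} cost_𝒞(u)` over subsets `T ⊆ V` of size `k`. -/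
def costTopK [Fintype V] {α : Type*} (E : V → V → Prop) (C : V → α) (k : ℕ) : ℕ :=
  (Finset.powersetCard k (Finset.univ : Finset V)).sup (fun T => ∑ u ∈ T, costC E C u)

/-- `d_H(u)`: the degree of `u` in the pruned graph `H`. -/
def dH [Fintype V] (β : ℝ) (E : V → V → Prop) (u : V) : ℕ := (NH β E u).card

/-- A vertex is heavy if it keeps at least a `(1−λ)` fraction of its neighbours in `H`
(i.e. it is not light: `d_H(v) ≥ (1−λ)·d(v)`). -/
def Heavy [Fintype V] (β lam : ℝ) (E : V → V → Prop) (v : V) : Prop :=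
  (1 - lam) * (deg E v : ℝ) ≤ (dH β E v : ℝ)

/-- The edge set `E_G̃ = {uv ∈ E_H : u or v is heavy}`. -/
def EGt [Fintype V] (β lam : ℝ) (E : V → V → Prop) (u v : V) : Prop :=
  EH β E u v ∧ (Heavy β lam E u ∨ Heavy β lam E v)

/-- The graph `G̃ = (V, E_G̃)`. -/
def Gtilde [Fintype V] (β lam : ℝ) (E : V → V → Prop) : SimpleGraph V :=
  SimpleGraph.fromRel (fun u v => EGt β lam E u v)

/-- The pre-clustering `F`: the partition of `V` into connected components of `G̃`,
given by the map sending each vertex to its connected component. -/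
def preCluster [Fintype V] (β lam : ℝ) (E : V → V → Prop) :
    V → (Gtilde β lam E).ConnectedComponent :=
  fun v => (Gtilde β lam E).connectedComponentMk v

/-- `φ^+_1(u)`: (other endpoints of) `+`edges incident to `u` that are cut in `𝒞`. -/
def phi1p [Fintype V] {α : Type*} (E : V → V → Prop) (C : V → α) (u : V) : Finset V :=
  Finset.univ.filter (fun v => E u v ∧ C u ≠ C v)

/-- `φ^+_2(u)`: (other endpoints of) edges of `E ∖ E_H` incident to `u` that are not
cut in `𝒞`. -/
def phi2p [Fintype V] {α : Type*} (β : ℝ) (E : V → V → Prop) (C : V → α) (u : V) :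
    Finset V :=
  Finset.univ.filter (fun v => E u v ∧ ¬ EH β E u v ∧ C u = C v)

/-- `φ^+_4(u)`: (other endpoints of) edges of `E_H ∖ E_G̃` incident to `u` that are
not cut in `𝒞`. -/
def phi4p [Fintype V] {α : Type*} (β lam : ℝ) (E : V → V → Prop) (C : V → α) (u : V) :
    Finset V :=
  Finset.univ.filter (fun v => EH β E u v ∧ ¬ EGt β lam E u v ∧ C u = C v)

/-- Some `k`-subset has all of its values of `f` above a threshold `θ ≥ 0` bounding `f`
outside of it. -/
lemma exists_card_eq_threshold [Fintype V] (f : V → ℝ) (hf : ∀ v, 0 ≤ f v) (k : ℕ)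
    (hk1 : 1 ≤ k) (hk2 : k ≤ Fintype.card V) :
    ∃ (T : Finset V) (θ : ℝ), T.card = k ∧ 0 ≤ θ ∧ (∀ v ∈ T, θ ≤ f v) ∧
      ∀ v ∉ T, f v ≤ θ := by
  have hne : (Finset.powersetCard k (Finset.univ : Finset V)).Nonempty := by
    rw [Finset.powersetCard_nonempty]
    simpa using hk2
  obtain ⟨T, hT, hmax⟩ := Finset.exists_max_image _ (fun T => ∑ v ∈ T, f v) hne
  have hcard : T.card = k := (Finset.mem_powersetCard.mp hT).2
  have hTne : T.Nonempty := Finset.card_pos.mp (by omega)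
  obtain ⟨t, ht, hmin⟩ := Finset.exists_min_image T f hTne
  refine ⟨T, f t, hcard, hf t, hmin, fun s hs => ?_⟩
  have hs' : s ∉ T.erase t := fun h => hs (Finset.mem_of_mem_erase h)
  have hmem : insert s (T.erase t) ∈ Finset.powersetCard k (Finset.univ : Finset V) := by
    rw [Finset.mem_powersetCard]
    refine ⟨Finset.subset_univ _, ?_⟩
    rw [Finset.card_insert_of_notMem hs', Finset.card_erase_of_mem ht]
    omega
  have h := hmax _ hmem
  simp only [Finset.sum_insert hs'] at h
  have h2 := Finset.add_sum_erase T f ht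
  linarith

lemma sum_costC_le_costTopK [Fintype V] {α : Type*} (E : V → V → Prop) (C : V → α)
    {k : ℕ} {U : Finset V} (hU : U.card = k) :
    ∑ u ∈ U, (costC E C u : ℝ) ≤ (costTopK E C k : ℝ) := by
  have hle : ∑ u ∈ U, costC E C u ≤ costTopK E C k :=
    Finset.le_sup (f := fun T => ∑ u ∈ T, costC E C u)
      (Finset.mem_powersetCard.mpr ⟨Finset.subset_univ _, hU⟩)
  exact_mod_cast hle

/-- Fractional weights in `[0, 1]` of total mass at most `k` collect at most the top-`k`
cost. -/
lemma sum_mul_costC_le_costTopK [Fintype V] {α : Type*} (E : V → V → Prop) (C : V → α)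
    (k : ℕ) (hk1 : 1 ≤ k) (hk2 : k ≤ Fintype.card V) (w : V → ℝ) (hw0 : ∀ v, 0 ≤ w v)
    (hw1 : ∀ v, w v ≤ 1) (hwk : ∑ v, w v ≤ k) :
    ∑ v, w v * (costC E C v : ℝ) ≤ (costTopK E C k : ℝ) := by
  obtain ⟨T, θ, hT, hθ, hin, hout⟩ :=
    exists_card_eq_threshold (fun v => (costC E C v : ℝ)) (fun v => by positivity) k hk1 hk2
  refine le_trans ?_ (sum_costC_le_costTopK E C hT)
  have hpt : ∀ v, w v * (costC E C v : ℝ)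
      ≤ (if v ∈ T then (costC E C v : ℝ) - θ else 0) + w v * θ := by
    intro v
    split_ifs with hv
    · nlinarith [hin v hv, hw1 v]
    · nlinarith [hout v hv, hw0 v]
  calc ∑ v, w v * (costC E C v : ℝ)
      ≤ ∑ v, ((if v ∈ T then (costC E C v : ℝ) - θ else 0) + w v * θ) :=
        Finset.sum_le_sum fun v _ => hpt v
    _ = (∑ v ∈ T, (costC E C v : ℝ) - k * θ) + (∑ v, w v) * θ := by
        rw [Finset.sum_add_distrib, ← Finset.sum_mul, Finset.sum_ite_mem, Finset.univ_inter,
          Finset.sum_sub_distrib, Finset.sum_const, hT, nsmul_eq_mul]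
    _ ≤ ∑ v ∈ T, (costC E C v : ℝ) := by nlinarith

lemma card_phi1p_le_costC [Fintype V] {α : Type*} (E : V → V → Prop) (C : V → α) (u : V) :
    (phi1p E C u).card ≤ costC E C u := by
  refine Finset.card_le_card fun v hv => ?_
  simp only [phi1p, Finset.mem_filter] at hv ⊢
  exact ⟨hv.1, Or.inl hv.2⟩

/-- Neighborhoods of two vertices of the same cluster differ by at most their total cost. -/
lemma card_symmDiff_Nbr_le [Fintype V] {α : Type*} (E : V → V → Prop) (hrefl : ∀ u, E u u)
    (C : V → α) {u v : V} (huv : C u = C v) :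
    (symmDiff (Nbr E u) (Nbr E v)).card ≤ costC E C u + costC E C v := by
  refine le_trans (Finset.card_le_card fun w hw => ?_) (Finset.card_union_le _ _)
  simp only [Finset.mem_symmDiff, Nbr, Finset.mem_filter, Finset.mem_univ, true_and,
    Finset.mem_union] at hw ⊢
  rcases hw with ⟨h1, h2⟩ | ⟨h1, h2⟩
  · have hne : w ≠ v := fun h => h2 (h ▸ hrefl v)
    by_cases hC : C u = C w
    · exact Or.inr (Or.inr ⟨h2, hne, huv ▸ hC⟩)
    · exact Or.inl (Or.inl ⟨h1, hC⟩)
  · have hne : w ≠ u := fun h => h2 (h ▸ hrefl u)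
    by_cases hC : C u = C w
    · exact Or.inl (Or.inr ⟨h2, hne, hC⟩)
    · exact Or.inr (Or.inl ⟨h1, huv ▸ hC⟩)

lemma deg_pos [Fintype V] (E : V → V → Prop) (hrefl : ∀ u, E u u) (u : V) : 0 < deg E u :=
  Finset.card_pos.mpr ⟨u, by simp [Nbr, hrefl]⟩

/-- Each edge of `φ₂⁺` is paid for by the costs of its endpoints. -/
lemma le_costC_div_add_of_mem_phi2p [Fintype V] {α : Type*} (E : V → V → Prop)
    (hrefl : ∀ u, E u u) {β : ℝ} (C : V → α) {u v : V} (hv : v ∈ phi2p β E C u) :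
    β ≤ (costC E C u : ℝ) / deg E u + (costC E C v : ℝ) / Mdeg E u v := by
  obtain ⟨hE, hH, hC⟩ := (Finset.mem_filter.mp hv).2
  have hlt : β * (Mdeg E u v : ℝ) < ((symmDiff (Nbr E u) (Nbr E v)).card : ℝ) := by
    by_contra h
    exact hH ⟨hE, not_lt.mp h⟩
  have hle : ((symmDiff (Nbr E u) (Nbr E v)).card : ℝ) ≤ costC E C u + costC E C v := by
    exact_mod_cast card_symmDiff_Nbr_le E hrefl C hC
  have hd : (0 : ℝ) < deg E u := by exact_mod_cast deg_pos E hrefl u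
  have hdM : (deg E u : ℝ) ≤ Mdeg E u v := by exact_mod_cast le_max_left _ _
  have hM : (0 : ℝ) < Mdeg E u v := hd.trans_le hdM
  calc β ≤ ((costC E C u : ℝ) + costC E C v) / Mdeg E u v := by
        rw [le_div_iff₀ hM]
        linarith
    _ = (costC E C u : ℝ) / Mdeg E u v + (costC E C v : ℝ) / Mdeg E u v := add_div _ _ _
    _ ≤ _ := by gcongr

lemma card_phi_add_le_deg [Fintype V] {α : Type*} (β lam : ℝ) (E : V → V → Prop) (C : V → α)
    (u : V) :
    (phi1p E C u).card + (phi2p β E C u).card + (phi4p β lam E C u).card ≤ deg E u := by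
  have h12 : Disjoint (phi1p E C u) (phi2p β E C u) := by
    rw [Finset.disjoint_left]
    intro v h1 h2
    simp only [phi1p, phi2p, Finset.mem_filter] at h1 h2
    exact h1.2.2 h2.2.2.2
  have h124 : Disjoint (phi1p E C u ∪ phi2p β E C u) (phi4p β lam E C u) := by
    rw [Finset.disjoint_left]
    intro v h1 h2
    simp only [phi1p, phi2p, phi4p, Finset.mem_filter, Finset.mem_union] at h1 h2
    rcases h1 with h1 | h1
    · exact h1.2.2 h2.2.2.2
    · exact h1.2.2.1 h2.2.1
  rw [← Finset.card_union_of_disjoint h12, ← Finset.card_union_of_disjoint h124]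
  refine Finset.card_le_card fun v hv => ?_
  simp only [phi1p, phi2p, phi4p, Nbr, Finset.mem_filter, Finset.mem_union,
    Finset.mem_univ, true_and] at hv ⊢
  rcases hv with (h | h) | h
  exacts [h.1, h.1, h.1.1]

/-- A vertex incident to an edge of `φ₄⁺` is light, so many of its edges lie in
`φ₁⁺ ∪ φ₂⁺`. -/
lemma mul_deg_le_of_phi4p_nonempty [Fintype V] {α : Type*} (β lam : ℝ) (E : V → V → Prop)
    (C : V → α) {u : V} (h : (phi4p β lam E C u).Nonempty) :
    lam * (deg E u : ℝ) ≤ ((phi1p E C u).card : ℝ) + ((phi2p β E C u).card : ℝ) := by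
  obtain ⟨v, hv⟩ := h
  obtain ⟨hH, hG, -⟩ := (Finset.mem_filter.mp hv).2
  have hlight : ¬ Heavy β lam E u := fun hh => hG ⟨hH, Or.inl hh⟩
  have hsub : Nbr E u ⊆ NH β E u ∪ (phi1p E C u ∪ phi2p β E C u) := by
    intro w hw
    simp only [Nbr, NH, phi1p, phi2p, Finset.mem_filter, Finset.mem_union,
      Finset.mem_univ, true_and] at hw ⊢
    tauto
  have hcard : deg E u ≤ dH β E u + ((phi1p E C u).card + (phi2p β E C u).card) :=
    (Finset.card_le_card hsub).trans
      ((Finset.card_union_le _ _).trans (Nat.add_le_add_left (Finset.card_union_le _ _) _))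
  have hcard' : (deg E u : ℝ) ≤
      dH β E u + (((phi1p E C u).card : ℝ) + ((phi2p β E C u).card : ℝ)) := by
    exact_mod_cast hcard
  unfold Heavy at hlight
  linarith [not_le.mp hlight]

/-- The bound on the contribution of a single vertex `u`: its own cost, plus the costs of
its `φ₂⁺`-neighbors `v` weighted by `1 / M_{uv}`. -/
lemma card_phi_add_le_cost [Fintype V] {α : Type*} (E : V → V → Prop) (hrefl : ∀ u, E u u)
    {β lam : ℝ} (hβ : 0 < β) (hlam : 0 < lam) (C : V → α) (u : V) :
    ((phi1p E C u).card : ℝ) + ((phi2p β E C u).card : ℝ) + ((phi4p β lam E C u).card : ℝ)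
      ≤ (1 + 1 / lam + 1 / β) * (costC E C u : ℝ)
        + (1 / β * (1 + 1 / lam)) *
          ∑ v ∈ phi2p β E C u, (costC E C v : ℝ) / (Mdeg E u v : ℝ) := by
  have hd : (0 : ℝ) < deg E u := by exact_mod_cast deg_pos E hrefl u
  have h1y : ((phi1p E C u).card : ℝ) ≤ costC E C u := by
    exact_mod_cast card_phi1p_le_costC E C u
  have hsum : ((phi1p E C u).card : ℝ) + ((phi2p β E C u).card : ℝ)
      + ((phi4p β lam E C u).card : ℝ) ≤ deg E u := by
    exact_mod_cast card_phi_add_le_deg β lam E C u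
  have hS : β * ((phi2p β E C u).card : ℝ) ≤
      ((phi2p β E C u).card : ℝ) * ((costC E C u : ℝ) / deg E u)
        + ∑ v ∈ phi2p β E C u, (costC E C v : ℝ) / (Mdeg E u v : ℝ) := by
    have h := Finset.sum_le_sum fun v (hv : v ∈ phi2p β E C u) =>
      le_costC_div_add_of_mem_phi2p E hrefl C hv
    rw [Finset.sum_add_distrib, Finset.sum_const, Finset.sum_const, nsmul_eq_mul,
      nsmul_eq_mul] at h
    linarith
  have hS0 : 0 ≤ ∑ v ∈ phi2p β E C u, (costC E C v : ℝ) / (Mdeg E u v : ℝ) :=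
    Finset.sum_nonneg fun _ _ => by positivity
  have hp1 : (0 : ℝ) ≤ (phi1p E C u).card := by positivity
  have hp2 : (0 : ℝ) ≤ (phi2p β E C u).card := by positivity
  have hy : (0 : ℝ) ≤ costC E C u := by positivity
  -- the `φ₄⁺` edges are distributed evenly over the edges of `φ₁⁺ ∪ φ₂⁺`
  obtain ⟨c, hc0, hc1, hc⟩ : ∃ c : ℝ, 0 ≤ c ∧ c ≤ 1 / lam ∧
      ((phi4p β lam E C u).card : ℝ) =
        c * (((phi1p E C u).card : ℝ) + ((phi2p β E C u).card : ℝ)) := by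
    rcases (phi4p β lam E C u).eq_empty_or_nonempty with h | h
    · exact ⟨0, le_rfl, by positivity, by simp [h]⟩
    · have hl := mul_deg_le_of_phi4p_nonempty β lam E C h
      have hpos := (mul_pos hlam hd).trans_le hl
      refine ⟨(phi4p β lam E C u).card / (((phi1p E C u).card : ℝ) + (phi2p β E C u).card),
        by positivity, ?_, (div_mul_cancel₀ _ hpos.ne').symm⟩
      rw [div_le_div_iff₀ hpos hlam]
      nlinarith
  generalize ∑ v ∈ phi2p β E C u, (costC E C v : ℝ) / (Mdeg E u v : ℝ) = S at *
  generalize ((phi1p E C u).card : ℝ) = p₁ at *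
  generalize ((phi2p β E C u).card : ℝ) = p₂ at *
  generalize ((phi4p β lam E C u).card : ℝ) = p₄ at *
  generalize (costC E C u : ℝ) = y at *
  generalize (deg E u : ℝ) = d at *
  subst hc
  have hfrac : (1 + c) * (p₂ * (y / d)) ≤ y := by
    rw [← mul_assoc, mul_div_assoc', div_le_iff₀ hd]
    nlinarith [mul_nonneg hc0 hp1]
  have h2 : β * ((1 + c) * p₂) ≤ y + (1 + 1 / lam) * S := by
    nlinarith [mul_le_mul_of_nonneg_left hS (by positivity : 0 ≤ 1 + c),
      mul_le_mul_of_nonneg_right hc1 hS0]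
  have h2' : (1 + c) * p₂ ≤ 1 / β * (y + (1 + 1 / lam) * S) := by
    rw [one_div, ← div_eq_inv_mul, le_div_iff₀ hβ]
    linarith
  have h1 : (1 + c) * p₁ ≤ (1 + 1 / lam) * y :=
    mul_le_mul (by linarith) h1y hp1 (by positivity)
  linarith

/-- `g^+_1 + g^+_2 + g^+_4 ≤ (3/β + 1/λ + 1/(βλ) + 1)·cost^k_𝒞`. -/
theorem g1_add_g2_add_g4_le [Fintype V] (E : V → V → Prop)
    (hsymm : ∀ u v, E u v → E v u) (hrefl : ∀ u, E u u)
    (β lam : ℝ) (hβ0 : 0 < β) (hβ1 : β < 1) (hlam0 : 0 < lam) (hlam1 : lam < 1)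
    {α : Type*} (C : V → α)
    (k : ℕ) (hk1 : 1 ≤ k) (hk2 : k ≤ Fintype.card V)
    (U : Finset V) (hU : U.card = k) :
    (∑ u ∈ U, ((phi1p E C u).card : ℝ))
      + (∑ u ∈ U, ((phi2p β E C u).card : ℝ))
      + (∑ u ∈ U, ((phi4p β lam E C u).card : ℝ))
      ≤ (3 / β + 1 / lam + 1 / (β * lam) + 1) * (costTopK E C k : ℝ) := by
  -- the total weight with which `v` is charged as the other endpoint of `φ₂⁺` edges
  let w : V → ℝ := fun v =>
    ∑ u ∈ U, if v ∈ phi2p β E C u then 1 / (Mdeg E u v : ℝ) else 0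
  have hd : ∀ u, (0 : ℝ) < deg E u := fun u => by exact_mod_cast deg_pos E hrefl u
  have hMl : ∀ u v, (deg E u : ℝ) ≤ Mdeg E u v := fun u v => by
    exact_mod_cast le_max_left _ _
  have hMr : ∀ u v, (deg E v : ℝ) ≤ Mdeg E u v := fun u v => by
    exact_mod_cast le_max_right _ _
  have hw0 : ∀ v, 0 ≤ w v := fun v => Finset.sum_nonneg fun u _ => by
    split_ifs <;> positivity
  have hnbr : ∀ u, (∑ v, if E u v then 1 / (deg E u : ℝ) else 0) = 1 := fun u => by
    rw [← Finset.sum_filter, Finset.sum_const, nsmul_eq_mul]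
    exact mul_one_div_cancel (hd u).ne'
  have hw1 : ∀ v, w v ≤ 1 := fun v => by
    rw [← hnbr v]
    refine le_trans (Finset.sum_le_sum fun u _ => ?_)
      (Finset.sum_le_sum_of_subset_of_nonneg (Finset.subset_univ U) fun u _ _ => ?_)
    · by_cases hv : v ∈ phi2p β E C u
      · have hE : E v u := hsymm _ _ (Finset.mem_filter.mp hv).2.1
        rw [if_pos hv, if_pos hE]
        exact one_div_le_one_div_of_le (hd v) (hMr u v)
      · rw [if_neg hv]
        split_ifs <;> positivity
    · split_ifs <;> positivity
  have hwk : ∑ v, w v ≤ k := by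
    rw [Finset.sum_comm]
    calc ∑ u ∈ U, ∑ v, (if v ∈ phi2p β E C u then 1 / (Mdeg E u v : ℝ) else 0)
        ≤ ∑ u ∈ U, (1 : ℝ) := Finset.sum_le_sum fun u _ => by
          refine (Finset.sum_le_sum fun v _ => ?_).trans_eq (hnbr u)
          by_cases hv : v ∈ phi2p β E C u
          · rw [if_pos hv, if_pos (Finset.mem_filter.mp hv).2.1]
            exact one_div_le_one_div_of_le (hd u) (hMl u v)
          · rw [if_neg hv]
            split_ifs <;> positivity
      _ = k := by simp [hU]
  have hK := sum_mul_costC_le_costTopK E C k hk1 hk2 w hw0 hw1 hwk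
  have hswap : ∑ v, w v * (costC E C v : ℝ)
      = ∑ u ∈ U, ∑ v ∈ phi2p β E C u, (costC E C v : ℝ) / (Mdeg E u v : ℝ) := by
    simp only [w, Finset.sum_mul]
    rw [Finset.sum_comm]
    refine Finset.sum_congr rfl fun u _ => ?_
    simp only [ite_mul, zero_mul, one_div_mul_eq_div]
    rw [Finset.sum_ite_mem, Finset.univ_inter]
  rw [hswap] at hK
  have hU' := sum_costC_le_costTopK E C hU
  have hmain := Finset.sum_le_sum fun u (_ : u ∈ U) =>
    card_phi_add_le_cost E hrefl hβ0 hlam0 C u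
  rw [Finset.sum_add_distrib, Finset.sum_add_distrib, Finset.sum_add_distrib,
    ← Finset.mul_sum, ← Finset.mul_sum] at hmain
  have hK0 : 0 ≤ 1 / β * (costTopK E C k : ℝ) := by positivity
  have e1 := mul_le_mul_of_nonneg_left hU' (by positivity : 0 ≤ 1 + 1 / lam + 1 / β)
  have e2 := mul_le_mul_of_nonneg_left hK (by positivity : 0 ≤ 1 / β * (1 + 1 / lam))
  have e3 : (3 / β + 1 / lam + 1 / (β * lam) + 1) * (costTopK E C k : ℝ)
      = (1 + 1 / lam + 1 / β) * (costTopK E C k : ℝ)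
        + 1 / β * (1 + 1 / lam) * (costTopK E C k : ℝ) + 1 / β * (costTopK E C k : ℝ) := by
    field_simp
    ring
  linarith

end
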